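/- Let 0 ≤ m ≤ n be integers, let f : ℝⁿ → [0,∞) be a bounded continuous function, and let E ⊆ ℝⁿ be a Borel set with H^m(E) < ∞. Then the m-dimensional f-Hausdorff measure of E equals the integral of f over E against H^m: lim_{δ→0⁺} inf{ Σ_{i=1}^∞ f(x_i)·ω(m)·2^{−m}·(diam U_i)^m : E ⊆ ⋃_{i=1}^∞ U_i, diam U_i ≤ δ, x_i ∈ U_i } = ∫_E f(x) dH^m(x). -/

import Mathlib

open MeasureTheory Metric Filter Set
open scoped ENNReal NNReal

noncomputable section

/-- `ω k`: the Lebesgue volume of the unit ball in `ℝᵏ`. -/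
def unitBallVol (k : ℕ) : ℝ :=
  (volume (Metric.ball (0 : EuclideanSpace ℝ (Fin k)) 1)).toReal

/-- The `m`-dimensional Hausdorff measure on `ℝⁿ`, obtained from Carathéodory's construction
with the gauge `ζ(U) = ω(m)·2^{-m}·(diam U)^m`; with this normalization it agrees with Lebesgue
measure on `m`-dimensional affine subspaces. -/
def normHausdorff (n m : ℕ) : Measure (EuclideanSpace ℝ (Fin n)) :=
  (ENNReal.ofReal (unitBallVol m / 2 ^ m)) • μH[(m : ℝ)]

/-- The size-`δ` approximation to the `m`-dimensional `f`-Hausdorff measure of `E ⊆ ℝⁿ`: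
the infimum, over all countable covers `E ⊆ ⋃ᵢ Uᵢ` by sets of diameter at most `δ` and all
choices of points `xᵢ ∈ Uᵢ`, of `Σᵢ f(xᵢ)·ω(m)·2^{−m}·(diam Uᵢ)^m` (empty sets of the cover
contribute nothing). -/
def fHausdorffApprox (n m : ℕ) (f : EuclideanSpace ℝ (Fin n) → ℝ) (δ : ℝ)
    (E : Set (EuclideanSpace ℝ (Fin n))) : ℝ≥0∞ :=
  ⨅ (U : ℕ → Set (EuclideanSpace ℝ (Fin n))) (x : ℕ → EuclideanSpace ℝ (Fin n))
    (_ : E ⊆ ⋃ i, U i) (_ : ∀ i, EMetric.diam (U i) ≤ ENNReal.ofReal δ)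
    (_ : ∀ i, (U i).Nonempty → x i ∈ U i),
    ∑' i, ⨆ (_ : (U i).Nonempty),
      ENNReal.ofReal (f (x i)) * ENNReal.ofReal (unitBallVol m / 2 ^ m) *
        EMetric.diam (U i) ^ m

section WeightedGauge

variable {X : Type*} [EMetricSpace X]

/-- The gauge `s ↦ (inf_s F) · φ (diam s)`, whose Carathéodory construction is the weighted
Hausdorff measure. -/
def weightedGauge (F : X → ℝ≥0∞) (φ : ℝ≥0∞ → ℝ≥0∞) (s : Set X) : ℝ≥0∞ :=
  ⨅ x ∈ s, F x * φ (ediam s)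

theorem mkMetric'_pre_weightedGauge [Nonempty X] (F : X → ℝ≥0∞) (φ : ℝ≥0∞ → ℝ≥0∞) (r : ℝ≥0∞)
    (E : Set X) :
    OuterMeasure.mkMetric'.pre (weightedGauge F φ) r E =
      ⨅ (U : ℕ → Set X) (x : ℕ → X) (_ : E ⊆ ⋃ i, U i) (_ : ∀ i, ediam (U i) ≤ r)
        (_ : ∀ i, (U i).Nonempty → x i ∈ U i),
        ∑' i, ⨆ (_ : (U i).Nonempty), F (x i) * φ (ediam (U i)) := by
  rw [OuterMeasure.mkMetric'.pre, OuterMeasure.boundedBy_apply]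
  refine le_antisymm ?_ ?_
  · refine le_iInf fun U => le_iInf fun x => le_iInf fun hE => le_iInf fun hU =>
      le_iInf fun hx => iInf₂_le_of_le U hE (ENNReal.tsum_le_tsum fun i => ?_)
    refine iSup_mono fun hi => ?_
    rw [extend_eq (P := fun s : Set X => ediam s ≤ r) _ (hU i)]
    exact iInf₂_le _ (hx i hi)
  · refine le_iInf₂ fun U hE => ?_
    by_cases hU : ∀ i, ediam (U i) ≤ r
    · refine ENNReal.le_of_forall_pos_le_add fun ε hε hfin => ?_
      obtain ⟨ε', hε', hsum⟩ := ENNReal.exists_pos_sum_of_countable'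
        (ENNReal.coe_ne_zero.2 hε.ne') ℕ
      have hterm : ∀ i, (U i).Nonempty → weightedGauge F φ (U i) ≠ ⊤ := by
        intro i hi
        have := ne_top_of_le_ne_top hfin.ne (ENNReal.le_tsum i)
        rwa [iSup_pos hi, extend_eq (P := fun s : Set X => ediam s ≤ r) _ (hU i)] at this
      have hex : ∀ i, ∃ y, (U i).Nonempty →
          y ∈ U i ∧ F y * φ (ediam (U i)) ≤ weightedGauge F φ (U i) + ε' i := by
        intro i
        by_cases hi : (U i).Nonempty
        · have hlt := ENNReal.lt_add_right (hterm i hi) (hε' i).ne'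
          conv_lhs at hlt => rw [weightedGauge]
          simp only [iInf_lt_iff] at hlt
          obtain ⟨y, hy, hlt⟩ := hlt
          exact ⟨y, fun _ => ⟨hy, hlt.le⟩⟩
        · exact ⟨Classical.arbitrary X, fun h => absurd h hi⟩
      choose x hx using hex
      refine iInf_le_of_le U <| iInf_le_of_le x <| iInf_le_of_le hE <| iInf_le_of_le hU <|
        iInf_le_of_le (fun i hi => (hx i hi).1) ?_
      refine le_trans ?_ (add_le_add_right hsum.le _)
      rw [← ENNReal.tsum_add]
      refine ENNReal.tsum_le_tsum fun i => iSup_le fun hi => ?_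
      rw [iSup_pos hi, extend_eq (P := fun s : Set X => ediam s ≤ r) _ (hU i)]
      exact (hx i hi).2
    · push Not at hU
      obtain ⟨i, hi⟩ := hU
      have hne : (U i).Nonempty := by
        by_contra h
        rw [not_nonempty_iff_eq_empty] at h
        simp [h] at hi
      have htop : (∑' n, ⨆ _ : (U n).Nonempty,
          extend (fun s (_ : ediam s ≤ r) => weightedGauge F φ s) (U n)) = ⊤ := by
        refine top_unique (le_trans ?_ (ENNReal.le_tsum i))
        rw [iSup_pos hne, extend_eq_top (P := fun s : Set X => ediam s ≤ r) _ hi.not_ge]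
      rw [htop]
      exact le_top

theorem mkMetric'_weightedGauge_le {F : X → ℝ≥0∞} {φ : ℝ≥0∞ → ℝ≥0∞} (hφ : Monotone φ)
    {A : Set X} {b : ℝ≥0∞} (hb0 : b ≠ 0) (hb : b ≠ ⊤) (hA : ∀ x ∈ A, F x ≤ b) :
    OuterMeasure.mkMetric' (weightedGauge F φ) A ≤ b * OuterMeasure.mkMetric φ A := by
  refine le_of_tendsto_of_tendsto' (OuterMeasure.mkMetric'.tendsto_pre _ A)
    (ENNReal.Tendsto.const_mul (OuterMeasure.mkMetric'.tendsto_pre _ A) (Or.inr hb)) fun r => ?_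
  have key : OuterMeasure.restrict A (OuterMeasure.mkMetric'.pre (weightedGauge F φ) r) ≤
      b • OuterMeasure.mkMetric'.pre (fun s => φ (ediam s)) r := by
    rw [OuterMeasure.mkMetric'.pre.eq_def (fun s => φ (ediam s)), OuterMeasure.smul_boundedBy hb,
      ennreal_smul_extend _ hb0, OuterMeasure.le_boundedBy]
    intro s
    by_cases hs : ediam s ≤ r
    · rw [extend_eq (P := fun s : Set X => ediam s ≤ r) _ hs, OuterMeasure.restrict_apply, smul_eq_mul]
      rcases (s ∩ A).eq_empty_or_nonempty with h | ⟨x, hx⟩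
      · simp [h]
      · have hd : ediam (s ∩ A) ≤ ediam s := ediam_mono inter_subset_left
        exact (OuterMeasure.mkMetric'.pre_le (hd.trans hs)).trans
          ((iInf₂_le x hx).trans (mul_le_mul' (hA x hx.2) (hφ hd)))
    · rw [extend_eq_top (P := fun s : Set X => ediam s ≤ r) _ hs]
      exact le_top
  simpa using key A

theorem le_mkMetric'_weightedGauge [MeasurableSpace X] [BorelSpace X] {F : X → ℝ≥0∞}
    (hF : Continuous F) {φ : ℝ≥0∞ → ℝ≥0∞} {A : Set X} {a : ℝ≥0∞} (ha : a ≠ ⊤)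
    (hA : ∀ x ∈ A, a < F x) :
    a * Measure.mkMetric φ A ≤ OuterMeasure.mkMetric' (weightedGauge F φ) A := by
  let B : ℕ → Set X := fun k => {x ∈ A | ∀ y, edist y x < (k : ℝ≥0∞)⁻¹ → a ≤ F y}
  have hBmono : Monotone B := fun k l hkl x hx =>
    ⟨hx.1, fun y hy => hx.2 y (hy.trans_le (ENNReal.inv_le_inv.2 (Nat.cast_le.2 hkl)))⟩
  have hBA : ⋃ k, B k = A := by
    refine subset_antisymm (iUnion_subset fun k x hx => hx.1) fun x hx => ?_
    obtain ⟨ε, hε, hball⟩ := EMetric.mem_nhds_iff.1 (hF.continuousAt.eventually_const_lt (hA x hx))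
    obtain ⟨k, hk⟩ := ENNReal.exists_inv_nat_lt hε.ne'
    exact mem_iUnion.2 ⟨k, hx, fun y hy => (hball (hy.trans hk)).le⟩
  conv_lhs => rw [← hBA, hBmono.measure_iUnion, ENNReal.mul_iSup]
  refine iSup_le fun k => le_trans ?_ (measure_mono (fun x hx => hx.1 : B k ⊆ A))
  rw [← OuterMeasure.coe_mkMetric]
  refine le_of_tendsto_of_tendsto
    (ENNReal.Tendsto.const_mul (OuterMeasure.mkMetric'.tendsto_pre _ (B k)) (Or.inr ha))
    (OuterMeasure.mkMetric'.tendsto_pre _ (B k)) ?_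
  filter_upwards [Ioo_mem_nhdsGT (ENNReal.inv_pos.2 (ENNReal.natCast_ne_top k))] with r hr
  have key : a • OuterMeasure.restrict (B k)
      (OuterMeasure.mkMetric'.pre (fun s => φ (ediam s)) r) ≤
        OuterMeasure.mkMetric'.pre (weightedGauge F φ) r := by
    rw [OuterMeasure.mkMetric'.le_pre]
    intro s hs
    rw [smul_apply, OuterMeasure.restrict_apply, smul_eq_mul]
    rcases (s ∩ B k).eq_empty_or_nonempty with h | ⟨x, hx⟩
    · simp [h]
    · refine le_iInf₂ fun y hy => mul_le_mul' ?_ ?_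
      · exact hx.2.2 y (((edist_le_ediam_of_mem hy hx.1).trans hs).trans_lt hr.2)
      · exact (measure_mono inter_subset_left).trans (OuterMeasure.mkMetric'.pre_le hs)
  simpa using key (B k)

theorem mkMetric'_weightedGauge_eq_lintegral [MeasurableSpace X] [BorelSpace X] {f : X → ℝ}
    (hf0 : ∀ x, 0 ≤ f x) (hf : Continuous f) {φ : ℝ≥0∞ → ℝ≥0∞} (hφ : Monotone φ) {E : Set X}
    (hE : MeasurableSet E) (hfin : Measure.mkMetric φ E ≠ ⊤) :
    OuterMeasure.mkMetric' (weightedGauge (fun x => ENNReal.ofReal (f x)) φ) E =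
      ∫⁻ x in E, ENNReal.ofReal (f x) ∂(Measure.mkMetric φ) := by
  set F : X → ℝ≥0∞ := fun x => ENNReal.ofReal (f x) with hFdef
  have hF : Continuous F := ENNReal.continuous_ofReal.comp hf
  set μ : Measure X := Measure.mkMetric φ with hμ
  set ν : Measure X := Measure.mkMetric' (weightedGauge F φ) with hν
  have hνapp : ∀ {s : Set X}, MeasurableSet s →
      ν s = OuterMeasure.mkMetric' (weightedGauge F φ) s := fun hs => toMeasure_apply _ _ hs
  rw [← hνapp hE]
  have hsandwich : ∀ ε : ℝ, 0 < ε → ν E ≤ ∫⁻ x in E, F x ∂μ + ENNReal.ofReal ε * μ E ∧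
      ∫⁻ x in E, F x ∂μ ≤ ν E + ENNReal.ofReal (2 * ε) * μ E := by
    intro ε hε
    let S : ℕ → Set X := fun j => E ∩ {x | ⌊f x / ε⌋₊ = j}
    have hSm : ∀ j, MeasurableSet (S j) := fun j => hE.inter
      ((Nat.measurable_floor.comp (hf.measurable.div_const ε)) (measurableSet_singleton j))
    have hSd : Pairwise (Function.onFun Disjoint S) := fun i j hij =>
      Set.disjoint_left.2 fun x hi hj => hij (hi.2.symm.trans hj.2)
    have hSE : ⋃ j, S j = E := by
      ext x
      simp [S]
    have hlow : ∀ j, ∀ x ∈ S j, j * ε ≤ f x := by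
      rintro j x ⟨-, rfl⟩
      exact (le_div_iff₀ hε).1 (Nat.floor_le (div_nonneg (hf0 x) hε.le))
    have hupp : ∀ j, ∀ x ∈ S j, f x < (j + 1) * ε := by
      rintro j x ⟨-, rfl⟩
      exact (div_lt_iff₀ hε).1 (Nat.lt_floor_add_one _)
    have hνE : ν E = ∑' j, ν (S j) := by rw [← measure_iUnion hSd hSm, hSE]
    have hμE : μ E = ∑' j, μ (S j) := by rw [← measure_iUnion hSd hSm, hSE]
    have hIE : ∫⁻ x in E, F x ∂μ = ∑' j, ∫⁻ x in S j, F x ∂μ := by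
      rw [← lintegral_iUnion hSm hSd, hSE]
    rw [hνE, hμE, hIE, ← ENNReal.tsum_mul_left, ← ENNReal.tsum_mul_left, ← ENNReal.tsum_add,
      ← ENNReal.tsum_add]
    refine ⟨ENNReal.tsum_le_tsum fun j => ?_, ENNReal.tsum_le_tsum fun j => ?_⟩
    · have hpos : 0 < (j + 1) * ε := by positivity
      calc ν (S j) ≤ ENNReal.ofReal ((j + 1) * ε) * μ (S j) := by
            rw [hνapp (hSm j), hμ, ← OuterMeasure.coe_mkMetric]
            exact mkMetric'_weightedGauge_le hφ (ENNReal.ofReal_pos.2 hpos).ne'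
              ENNReal.ofReal_ne_top fun x hx => ENNReal.ofReal_le_ofReal (hupp j x hx).le
        _ = ENNReal.ofReal (j * ε) * μ (S j) + ENNReal.ofReal ε * μ (S j) := by
            rw [← add_mul, ← ENNReal.ofReal_add (by positivity) hε.le]
            ring_nf
        _ ≤ _ := by
            gcongr
            rw [← setLIntegral_const]
            exact setLIntegral_mono hF.measurable fun x hx =>
              ENNReal.ofReal_le_ofReal (hlow j x hx)
    · calc ∫⁻ x in S j, F x ∂μ ≤ ENNReal.ofReal ((j + 1) * ε) * μ (S j) := by
            rw [← setLIntegral_const]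
            exact setLIntegral_mono measurable_const fun x hx =>
              ENNReal.ofReal_le_ofReal (hupp j x hx).le
        _ ≤ ENNReal.ofReal ((j - 1) * ε) * μ (S j) + ENNReal.ofReal (2 * ε) * μ (S j) := by
            rw [← add_mul]
            gcongr
            refine le_trans (le_of_eq ?_) ENNReal.ofReal_add_le
            ring_nf
        _ ≤ _ := by
            gcongr
            rcases Nat.eq_zero_or_pos j with rfl | hj
            · rw [ENNReal.ofReal_of_nonpos (by simp [hε.le]), zero_mul]
              exact zero_le
            · rw [hνapp (hSm j)]
              refine le_mkMetric'_weightedGauge hF ENNReal.ofReal_ne_top fun x hx => ?_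
              have hjε : 0 < (j : ℝ) * ε := by positivity
              have := hlow j x hx
              exact (ENNReal.ofReal_lt_ofReal_iff (by linarith)).2 (by nlinarith)
  have hlim : ∀ (C : ℝ) (c : ℝ≥0∞),
      Tendsto (fun ε : ℝ => c + ENNReal.ofReal (C * ε) * μ E) (nhdsWithin 0 (Ioi 0)) (nhds c) := by
    intro C c
    have h : Tendsto (fun ε : ℝ => ENNReal.ofReal (C * ε)) (nhdsWithin 0 (Ioi 0)) (nhds 0) := by
      have : Continuous fun ε : ℝ => ENNReal.ofReal (C * ε) :=
        ENNReal.continuous_ofReal.comp (continuous_const.mul continuous_id)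
      simpa using (this.tendsto 0).mono_left nhdsWithin_le_nhds
    simpa using (ENNReal.Tendsto.mul_const h (Or.inr hfin)).const_add c
  refine le_antisymm (ge_of_tendsto (hlim 1 _) ?_) (ge_of_tendsto (hlim 2 _) ?_)
  · filter_upwards [self_mem_nhdsWithin] with ε hε
    simpa using (hsandwich ε hε).1
  · filter_upwards [self_mem_nhdsWithin] with ε hε
    exact (hsandwich ε hε).2

end WeightedGauge

theorem unitBallVol_pos (k : ℕ) : 0 < unitBallVol k :=
  ENNReal.toReal_pos (measure_ball_pos volume _ one_pos).ne' measure_ball_lt_top.ne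

/-- For `0 ≤ m ≤ n`, a bounded continuous `f : ℝⁿ → [0,∞)` and a Borel set
`E ⊆ ℝⁿ` with `H^m(E) < ∞`, the `m`-dimensional `f`-Hausdorff measure of `E`, i.e.
`lim_{δ→0⁺}` of the size-`δ` approximations, equals `∫_E f dH^m`. -/
theorem fHausdorff_eq_lintegral {m n : ℕ} (hmn : m ≤ n)
    (f : EuclideanSpace ℝ (Fin n) → ℝ) (hf0 : ∀ x, 0 ≤ f x)
    (hfbd : ∃ C : ℝ, ∀ x, f x ≤ C) (hfcont : Continuous f)
    (E : Set (EuclideanSpace ℝ (Fin n))) (hE : MeasurableSet E)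
    (hEfin : normHausdorff n m E < ⊤) :
    Filter.Tendsto (fun δ : ℝ => fHausdorffApprox n m f δ E)
      (nhdsWithin 0 (Set.Ioi 0))
      (nhds (∫⁻ x in E, ENNReal.ofReal (f x) ∂(normHausdorff n m))) := by
  have hc : 0 < unitBallVol m / 2 ^ m := div_pos (unitBallVol_pos m) (by positivity)
  set c : ℝ := unitBallVol m / 2 ^ m with hcdef
  have hμ : (μH[(m : ℝ)] : Measure (EuclideanSpace ℝ (Fin n))) =
      Measure.mkMetric fun r => r ^ m := by
    simp only [Measure.hausdorffMeasure, ENNReal.rpow_natCast]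
  have hnorm : normHausdorff n m = ENNReal.ofReal c • Measure.mkMetric fun r => r ^ m := by
    rw [normHausdorff, hμ]
  have hfin : (Measure.mkMetric fun r => r ^ m : Measure (EuclideanSpace ℝ (Fin n))) E ≠ ⊤ := by
    intro h
    rw [hnorm, Measure.smul_apply, h, smul_eq_mul,
      ENNReal.mul_top (ENNReal.ofReal_pos.2 hc).ne'] at hEfin
    exact hEfin.ne rfl
  have hint : ∫⁻ x in E, ENNReal.ofReal (f x) ∂(normHausdorff n m) =
      OuterMeasure.mkMetric' (weightedGauge (fun x => ENNReal.ofReal (f x * c)) fun r => r ^ m)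
        E := by
    rw [mkMetric'_weightedGauge_eq_lintegral (fun x => mul_nonneg (hf0 x) hc.le)
      (hfcont.mul_const c) (fun r s h => pow_le_pow_left' h m) hE hfin, hnorm,
      Measure.restrict_smul, lintegral_smul_measure, smul_eq_mul, mul_comm,
      ← lintegral_mul_const' _ _ ENNReal.ofReal_ne_top]
    simp only [ENNReal.ofReal_mul (hf0 _)]
  have happrox : ∀ δ : ℝ, fHausdorffApprox n m f δ E = OuterMeasure.mkMetric'.pre
      (weightedGauge (fun x => ENNReal.ofReal (f x * c)) fun r => r ^ m) (ENNReal.ofReal δ) E := by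
    intro δ
    rw [mkMetric'_pre_weightedGauge]
    simp only [ENNReal.ofReal_mul (hf0 _)]
    rfl
  simp only [happrox, hint]
  refine (OuterMeasure.mkMetric'.tendsto_pre _ E).comp (tendsto_nhdsWithin_iff.2 ⟨?_, ?_⟩)
  · simpa using (ENNReal.continuous_ofReal.tendsto 0).mono_left nhdsWithin_le_nhds
  · filter_upwards [self_mem_nhdsWithin] with δ hδ
    exact ENNReal.ofReal_pos.2 hδ
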